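/- For every n > 1, every nondeterministic Muller word automaton accepting the complement Σ_n^ω \ L(FB_n) has at least L(n) states. -/

import Mathlib

namespace YanPaper

/-- A finite run, represented as the list of visited states, over a finite word. -/
def RunOn {S A : Type*} (Δ : S → A → S → Prop) : List S → List A → Prop
  | [_], [] => True
  | p :: q :: ρ, a :: w => Δ p a q ∧ RunOn Δ (q :: ρ) w
  | _, _ => False

/-- `p` reaches `q` via some finite run over the word `w`. -/
def Reaches {S A : Type*} (Δ : S → A → S → Prop) (p : S) (w : List A) (q : S) : Prop :=
  ∃ ρ : List S, RunOn Δ ρ w ∧ ρ.head? = some p ∧ ρ.getLast? = some q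

/-- `p` reaches `q` via some finite run over `w` that visits the set `T`. -/
def ReachesVisit {S A : Type*} (Δ : S → A → S → Prop) (T : Set S) (p : S) (w : List A)
    (q : S) : Prop :=
  ∃ ρ : List S, RunOn Δ ρ w ∧ ρ.head? = some p ∧ ρ.getLast? = some q ∧ ∃ s ∈ ρ, s ∈ T

/-- Nondeterministic finite word automaton. -/
structure NFW (A : Type*) (S : Type*) where
  I : Set S
  Δ : S → A → S → Prop
  F : Set S

def NFW.Lang {A S : Type*} (M : NFW A S) : Set (List A) :=
  {w | ∃ p ∈ M.I, ∃ q ∈ M.F, Reaches M.Δ p w q}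

/-- The full NFW over state set `S`: the alphabet is the set of all binary relations on `S`. -/
def FullNFW (S : Type*) (I F : Set S) : NFW (Set (S × S)) S where
  I := I
  Δ := fun p a q => (p, q) ∈ a
  F := F

/-- Minimal number of states of an NFW over alphabet `A` accepting the language `L`. -/
noncomputable def NFWminStates (A : Type*) (L : Set (List A)) : ℕ :=
  sInf {c : ℕ | ∃ C : NFW A (Fin c), C.Lang = L}

/-- A two letter alphabet. -/
inductive AB : Type
  | a : AB
  | b : AB

/-- States occurring infinitely often in an infinite run. -/
def InfOcc {S : Type*} (ρ : ℕ → S) : Set S := {s | ∀ n : ℕ, ∃ m, n ≤ m ∧ ρ m = s}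

/-- Nondeterministic Büchi word automaton. -/
structure NBW (A : Type*) (S : Type*) where
  I : Set S
  Δ : S → A → S → Prop
  F : Set S

def NBW.Lang {A S : Type*} (M : NBW A S) : Set (ℕ → A) :=
  {α | ∃ ρ : ℕ → S, ρ 0 ∈ M.I ∧ (∀ i, M.Δ (ρ i) (α i) (ρ (i + 1))) ∧
        (InfOcc ρ ∩ M.F).Nonempty}

/-- The full NBW over state set `S`. -/
def FullNBW (S : Type*) (I F : Set S) : NBW (Set (S × S)) S where
  I := I
  Δ := fun p a q => (p, q) ∈ a
  F := F

/-- Minimal number of states of an NBW over alphabet `A` accepting the ω-language `L`. -/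
noncomputable def NBWminStates (A : Type*) (L : Set (ℕ → A)) : ℕ :=
  sInf {c : ℕ | ∃ C : NBW A (Fin c), C.Lang = L}

/-- Vertex `(q, l)` of the Δ-graph of `α` is reachable from an initial vertex `(q_I, 0)`. -/
def GraphReach {A S : Type*} (M : NBW A S) (α : ℕ → A) (q : S) (l : ℕ) : Prop :=
  ∃ ρ : ℕ → S, ρ 0 ∈ M.I ∧ (∀ i, i < l → M.Δ (ρ i) (α i) (ρ (i + 1))) ∧ ρ l = q

/-- A co-Büchi ranking for the Δ-graph of `α` under `M`, as a partial function
`S × ℕ → {0, …, 2n-2}` represented with `Option ℕ`. -/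
def CRanking {A S : Type*} [Fintype S] (M : NBW A S) (α : ℕ → A)
    (f : S → ℕ → Option ℕ) : Prop :=
  (∀ q l r, f q l = some r → r ≤ 2 * Fintype.card S - 2) ∧
  (∀ q l, (f q l).isSome ↔ GraphReach M α q l) ∧
  (∀ q l r, f q l = some r → Odd r → q ∉ M.F) ∧
  (∀ q l q', M.Δ q (α l) q' → ∀ r r', f q l = some r → f q' (l + 1) = some r' → r' ≤ r)

/-- The C-ranking `f` is odd: every infinite path of the Δ-graph starting at an initial
vertex has infinitely many odd-ranked vertices. -/
def OddCRanking {A S : Type*} [Fintype S] (M : NBW A S) (α : ℕ → A)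
    (f : S → ℕ → Option ℕ) : Prop :=
  ∀ ρ : ℕ → S, ρ 0 ∈ M.I → (∀ i, M.Δ (ρ i) (α i) (ρ (i + 1))) →
    ∀ N : ℕ, ∃ l, N ≤ l ∧ ∃ r, f (ρ l) l = some r ∧ Odd r

/-- The state space of the full NBW `FB n`: `none` is the final state `s_f`, and
`some i` is the main state `s_i`. -/
abbrev FBState (n : ℕ) := Option (Fin (n - 1))

/-- The alphabet of a full automaton with state space `FBState n`. -/
abbrev FBAlpha (n : ℕ) := Set (FBState n × FBState n)

/-- The full NBW `FB n`, with `n` states, main states initial and `s_f = none` final. -/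
def FB (n : ℕ) : NBW (FBAlpha n) (FBState n) where
  I := {s | s ≠ none}
  Δ := fun p a q => (p, q) ∈ a
  F := {none}

/-- A `Q(m)`-ranking for `FB n`: a function on the main states with values in
`{0, …, 2m-1}` whose range contains all odd numbers in `{0, …, 2m-1}`. -/
def QRanking (n m : ℕ) (g : Fin (n - 1) → ℕ) : Prop :=
  (∀ q, g q < 2 * m) ∧ ∀ r, r < 2 * m → Odd r → ∃ q, g q = r

/-- `w` is an `(f, g)`-segment for `FB n` (properties (P1), (P2), (P3)). -/
def IsSeg (n : ℕ) (f g : Fin (n - 1) → ℕ) (w : List (FBAlpha n)) : Prop :=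
  w ≠ [] ∧
  (∀ p q : Fin (n - 1),
    Reaches (FB n).Δ (some p) w (some q) ↔ (g q < f p ∨ (f p = g q ∧ Odd (f p)))) ∧
  (∀ p q : Fin (n - 1),
    ReachesVisit (FB n).Δ {none} (some p) w (some q) ↔ g q < f p) ∧
  (∀ p q : FBState n, Reaches (FB n).Δ p w q → p ≠ none ∧ q ≠ none)

/-- `L(n, m)`: the number of `Q(m)`-rankings for `FB n`. -/
noncomputable def Lnm (n m : ℕ) : ℕ := Nat.card {g : Fin (n - 1) → ℕ // QRanking n m g}

/-- `L(n) = max_{1 ≤ m < n} L(n, m)`. -/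
noncomputable def Lmax (n : ℕ) : ℕ := (Finset.Ico 1 n).sup (fun m => Lnm n m)

/-- Nondeterministic Muller word automaton. -/
structure NMW (A : Type*) (S : Type*) where
  I : Set S
  Δ : S → A → S → Prop
  Acc : Set (Set S)

def NMW.Lang {A S : Type*} (M : NMW A S) : Set (ℕ → A) :=
  {α | ∃ ρ : ℕ → S, ρ 0 ∈ M.I ∧ (∀ i, M.Δ (ρ i) (α i) (ρ (i + 1))) ∧ InfOcc ρ ∈ M.Acc}

/-- Nondeterministic generalized Büchi word automaton of index `k`. -/
structure NGBW (A : Type*) (S : Type*) where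
  I : Set S
  Δ : S → A → S → Prop
  k : ℕ
  F : Fin k → Set S

def NGBW.Lang {A S : Type*} (M : NGBW A S) : Set (ℕ → A) :=
  {α | ∃ ρ : ℕ → S, ρ 0 ∈ M.I ∧ (∀ i, M.Δ (ρ i) (α i) (ρ (i + 1))) ∧
        ∀ i, (InfOcc ρ ∩ M.F i).Nonempty}

/-- Nondeterministic Streett word automaton of index `k`. -/
structure NSW (A : Type*) (S : Type*) where
  I : Set S
  Δ : S → A → S → Prop
  k : ℕ
  acc : Fin k → Set S × Set S

def NSW.Lang {A S : Type*} (M : NSW A S) : Set (ℕ → A) :=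
  {α | ∃ ρ : ℕ → S, ρ 0 ∈ M.I ∧ (∀ i, M.Δ (ρ i) (α i) (ρ (i + 1))) ∧
        ∀ i, (InfOcc ρ ∩ (M.acc i).2).Nonempty → (InfOcc ρ ∩ (M.acc i).1).Nonempty}

/-- Nondeterministic Rabin word automaton of index `k`. -/
structure NRW (A : Type*) (S : Type*) where
  I : Set S
  Δ : S → A → S → Prop
  k : ℕ
  acc : Fin k → Set S × Set S

def NRW.Lang {A S : Type*} (M : NRW A S) : Set (ℕ → A) :=
  {α | ∃ ρ : ℕ → S, ρ 0 ∈ M.I ∧ (∀ i, M.Δ (ρ i) (α i) (ρ (i + 1))) ∧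
        ∃ i, (InfOcc ρ ∩ (M.acc i).1).Nonempty ∧ InfOcc ρ ∩ (M.acc i).2 = ∅}

/-- The `k`-fold concatenation `w^k` of a finite word. -/
def listPow {A : Type*} (w : List A) (k : ℕ) : List A := (List.replicate k w).flatten

/-- `α` is the ω-word `u · v^ω`. -/
def IsUVOmega {A : Type*} (u v : List A) (α : ℕ → A) : Prop :=
  (∀ i (h : i < u.length), α i = u.get ⟨i, h⟩) ∧
  (∀ i j (h : j < v.length), α (u.length + i * v.length + j) = v.get ⟨j, h⟩)

/-- A GC-segment of the NGBW `B`: a nonempty finite word `w` with `w^ω ∉ L(B)`. -/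
def GCSeg {A S : Type*} (B : NGBW A S) (w : List A) : Prop :=
  w ≠ [] ∧ ∀ α, IsUVOmega [] w α → α ∉ B.Lang

/-- Two GC-segments conflict: every ω-word `w₁^{k₀} (w₁^{k₁} w₂^{k₂})^ω` is in `L(B)`. -/
def Conflict {A S : Type*} (B : NGBW A S) (w₁ w₂ : List A) : Prop :=
  ∀ k₀ k₁ k₂ : ℕ, 0 < k₀ → 0 < k₁ → 0 < k₂ →
    ∀ α, IsUVOmega (listPow w₁ k₀) (listPow w₁ k₁ ++ listPow w₂ k₂) α → α ∈ B.Lang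

/-- The full NGBW `FB (n,k)` with all states initial, distinguished state `s_nf = none`,
and acceptance sets `F i` (subsets of the main states). -/
def FBgen (n k : ℕ) (F : Fin k → Finset (Fin (n - 1))) :
    NGBW (FBAlpha n) (FBState n) where
  I := Set.univ
  Δ := fun p a q => (p, q) ∈ a
  k := k
  F := fun i => {s | ∃ q ∈ F i, s = some q}

/-- The conditions on the acceptance condition of `FB (n,k)`: the sets are pairwise
distinct, each of size `⌊(n-1)/2⌋`, and each main state avoids at least `⌊k/2⌋` sets. -/
def GoodAcc (n k : ℕ) (F : Fin k → Finset (Fin (n - 1))) : Prop :=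
  Function.Injective F ∧ (∀ i, (F i).card = (n - 1) / 2) ∧
  ∀ q : Fin (n - 1), k / 2 ≤ {i : Fin k | q ∉ F i}.ncard

/-- A PGCL-ranking for `FB (n,k)`: `f` is a bijection from the main states onto
`{1, …, n-1}` and `g` chooses for each main state `q` an index with `q ∉ F (g q)`. -/
def PGCL (n k : ℕ) (F : Fin k → Finset (Fin (n - 1)))
    (f : Fin (n - 1) → ℕ) (g : Fin (n - 1) → Fin k) : Prop :=
  (∀ p, 1 ≤ f p ∧ f p ≤ n - 1) ∧ Function.Injective f ∧
  (∀ r, 1 ≤ r → r ≤ n - 1 → ∃ p, f p = r) ∧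
  ∀ q, q ∉ F (g q)

/-- `ρ` is a finite run over `w` from `p` to `q`. -/
def RunFromTo {S A : Type*} (Δ : S → A → S → Prop) (w : List A) (p q : S)
    (ρ : List S) : Prop :=
  RunOn Δ ρ w ∧ ρ.head? = some p ∧ ρ.getLast? = some q

/-- `w` is an `⟨f, g⟩`-segment for `FB (n,k)` (properties (Q0)–(Q3)). -/
def IsSegGen (n k : ℕ) (F : Fin k → Finset (Fin (n - 1)))
    (f : Fin (n - 1) → ℕ) (g : Fin (n - 1) → Fin k)
    (w : List (FBAlpha n)) : Prop :=
  w ≠ [] ∧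
  -- (Q0) every finite run over `w` ends in a main state
  (∀ (ρ : List (FBState n)) (x : FBState n),
    RunOn (FBgen n k F).Δ ρ w → ρ.getLast? = some x → x ≠ none) ∧
  -- (Q1)
  (∀ p : Fin (n - 1),
    (∃! ρ, RunFromTo (FBgen n k F).Δ w (some p) (some p) ρ) ∧
    ∀ ρ, RunFromTo (FBgen n k F).Δ w (some p) (some p) ρ →
      (∀ i, i ≠ g p → ∃ s ∈ ρ, ∃ q ∈ F i, s = some q) ∧
      (∀ s ∈ ρ, ∀ q ∈ F (g p), s ≠ some q)) ∧
  -- (Q2)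
  (∀ p q : Fin (n - 1), f q < f p →
    (∃! ρ, RunFromTo (FBgen n k F).Δ w (some p) (some q) ρ) ∧
    ∀ ρ, RunFromTo (FBgen n k F).Δ w (some p) (some q) ρ →
      ∀ i, ∃ s ∈ ρ, ∃ r ∈ F i, s = some r) ∧
  -- (Q3)
  (∀ p q : Fin (n - 1), f p < f q →
    ¬∃ ρ, RunFromTo (FBgen n k F).Δ w (some p) (some q) ρ)

/-! ### Auxiliary material for the proof -/

/-- The time map that unrolls the loop `[a, b)` forever. -/
def lp (a b t : ℕ) : ℕ := if t < a then t else a + (t - a) % (b - a)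

lemma lp_lt {a b : ℕ} (h : a < b) (t : ℕ) : lp a b t < b := by
  unfold lp
  split_ifs with h1
  · omega
  · have := Nat.mod_lt (t - a) (show 0 < b - a by omega)
    omega

lemma lp_ge {a b : ℕ} (t : ℕ) (ht : a ≤ t) : a ≤ lp a b t := by
  unfold lp
  split_ifs with h1 <;> omega

lemma lp_zero {a b : ℕ} : lp a b 0 = 0 := by
  unfold lp
  split_ifs with h1
  · rfl
  · have : a = 0 := by omega
    subst this; simp

lemma lp_succ {a b : ℕ} (h : a < b) (t : ℕ) :
    lp a b (t + 1) = lp a b t + 1 ∨ (lp a b t + 1 = b ∧ lp a b (t + 1) = a) := by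
  unfold lp
  by_cases h1 : t + 1 < a
  · left; rw [if_pos h1, if_pos (by omega)]
  · rw [if_neg h1]
    by_cases h2 : t < a
    · left
      have : t + 1 - a = 0 := by omega
      rw [if_pos h2, this]; simp; omega
    · rw [if_neg h2]
      have e : t + 1 - a = (t - a) + 1 := by omega
      have hm := Nat.mod_lt (t - a) (show 0 < b - a by omega)
      rw [e]
      by_cases h3 : (t - a) % (b - a) + 1 = b - a
      · right
        refine ⟨by omega, ?_⟩
        have : (t - a + 1) % (b - a) = 0 := by
          rw [← Nat.mod_add_mod, h3, Nat.mod_self]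
        omega
      · left
        have : (t - a + 1) % (b - a) = (t - a) % (b - a) + 1 := by
          rw [← Nat.mod_add_mod, Nat.mod_eq_of_lt (by omega)]
        omega

lemma lp_hit {a b s : ℕ} (h1 : a ≤ s) (h2 : s < b) (N : ℕ) : ∃ t, N ≤ t ∧ lp a b t = s := by
  refine ⟨s + (b - a) * N, ?_, ?_⟩
  · have : 1 * N ≤ (b - a) * N := Nat.mul_le_mul_right _ (by omega)
    omega
  · unfold lp
    rw [if_neg (by omega)]
    have : s + (b - a) * N - a = (s - a) + (b - a) * N := by omega
    rw [this, Nat.add_mul_mod_self_left, Nat.mod_eq_of_lt (by omega)]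
    omega

lemma loop_run {S A : Type*} (Δ : S → A → S → Prop) (α : ℕ → A) (r : ℕ → S) {a b : ℕ}
    (h : a < b) (hr : ∀ i, i < b → Δ (r i) (α i) (r (i + 1))) (hab : r a = r b) (i : ℕ) :
    Δ (r (lp a b i)) (α (lp a b i)) (r (lp a b (i + 1))) := by
  have h0 := hr _ (lp_lt h i)
  rcases lp_succ h i with h1 | ⟨h1, h2⟩
  · rw [h1]; exact h0
  · rw [h1] at h0
    rw [h2, hab]; exact h0

lemma loop_inf {S : Type*} (r : ℕ → S) {a b : ℕ} (h : a < b) (s : S) :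
    s ∈ InfOcc (fun t => r (lp a b t)) ↔ ∃ t, a ≤ t ∧ t < b ∧ r t = s := by
  constructor
  · intro hs
    obtain ⟨t, ht, e⟩ := hs a
    exact ⟨lp a b t, lp_ge t ht, lp_lt h t, e⟩
  · rintro ⟨t, h1, h2, e⟩ N
    obtain ⟨u, hu, e'⟩ := lp_hit h1 h2 N
    exact ⟨u, hu, by simp only [e', e]⟩

/-- Letter moving the rank-`k` main states to the final state. -/
def letA (n : ℕ) (f : Fin (n - 1) → ℕ) (k : ℕ) : FBAlpha n :=
  {x | ∃ p, x.1 = some p ∧ (x.2 = some p ∨ (x.2 = none ∧ f p = k))}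

/-- Letter passing from ranking `f` to ranking `g`. -/
def letM (n : ℕ) (f g : Fin (n - 1) → ℕ) (k : ℕ) : FBAlpha n :=
  {x | ∃ q, x.2 = some q ∧ ((∃ p, x.1 = some p ∧ g q ≤ f p) ∨ (x.1 = none ∧ g q < k))}

/-- The ω-word following a sequence of rankings and thresholds. -/
def wd (n : ℕ) (f : ℕ → Fin (n - 1) → ℕ) (k : ℕ → ℕ) (t : ℕ) : FBAlpha n :=
  if t % 2 = 0 then letA n (f (t / 2)) (k (t / 2))
  else letM n (f (t / 2)) (f (t / 2 + 1)) (k (t / 2))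

lemma wd_even (n : ℕ) (f : ℕ → Fin (n - 1) → ℕ) (k : ℕ → ℕ) (i : ℕ) :
    wd n f k (2 * i) = letA n (f i) (k i) := by
  have h1 : 2 * i % 2 = 0 := by omega
  have h2 : 2 * i / 2 = i := by omega
  simp [wd]

lemma wd_odd (n : ℕ) (f : ℕ → Fin (n - 1) → ℕ) (k : ℕ → ℕ) (i : ℕ) :
    wd n f k (2 * i + 1) = letM n (f i) (f (i + 1)) (k i) := by
  have h1 : (2 * i + 1) % 2 = 1 := by omega
  have h2 : (2 * i + 1) / 2 = i := by omega
  simp [wd, h1, h2]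

lemma wd_not_mem (n : ℕ) (f : ℕ → Fin (n - 1) → ℕ) (k : ℕ → ℕ) :
    wd n f k ∉ (FB n).Lang := by
  rintro ⟨s, -, hs, x, hx, hxF⟩
  have hxn : x = none := hxF
  subst hxn
  have hev : ∀ i, ∃ p, s (2 * i) = some p := by
    intro i
    have := hs (2 * i)
    rw [wd_even] at this
    obtain ⟨p, hp, -⟩ := this
    exact ⟨p, hp⟩
  choose x hx' using hev
  have key : ∀ i, f (i + 1) (x (i + 1)) ≤ f i (x i) ∧
      (s (2 * i + 1) = none → f (i + 1) (x (i + 1)) < f i (x i)) := by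
    intro i
    have h1 := hs (2 * i)
    have h2 := hs (2 * i + 1)
    rw [wd_even] at h1
    rw [wd_odd] at h2
    obtain ⟨p, hp, hp'⟩ := h1
    obtain ⟨q, hq, hq'⟩ := h2
    simp only at hp hp' hq hq'
    rw [show 2 * i + 1 + 1 = 2 * (i + 1) by ring, hx'] at hq
    rw [hx'] at hp
    cases hp; cases hq
    rcases hp' with hp' | ⟨hp', hk⟩
    · rcases hq' with ⟨p2, h3, h4⟩ | ⟨h3, -⟩
      · rw [hp'] at h3; cases h3
        refine ⟨h4, fun h => ?_⟩
        rw [hp'] at h; cases h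
      · rw [hp'] at h3; cases h3
    · rcases hq' with ⟨p2, h3, h4⟩ | ⟨h3, h4⟩
      · rw [hp'] at h3; cases h3
      · exact ⟨by omega, fun _ => by omega⟩
  have hanti : Antitone (fun i => f i (x i)) := antitone_nat_of_succ_le fun i => (key i).1
  -- descend
  have hdesc : ∀ N, ∃ i, f i (x i) + N ≤ f 0 (x 0) := by
    intro N
    induction N with
    | zero => exact ⟨0, by simp⟩
    | succ N ih =>
      obtain ⟨i, hi⟩ := ih
      obtain ⟨t, ht, e⟩ := hx (2 * i)
      rcases Nat.even_or_odd' t with ⟨j, rfl | rfl⟩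
      · rw [hx'] at e; cases e
      · have h1 := (key j).2 e
        have h2 : f j (x j) ≤ f i (x i) := hanti (by omega)
        exact ⟨j + 1, by omega⟩
  obtain ⟨i, hi⟩ := hdesc (f 0 (x 0) + 1)
  omega

/-- Accepting runs on unrolled words, from a sequence of main states with one drop. -/
lemma wd_loop_mem (n : ℕ) (f : ℕ → Fin (n - 1) → ℕ) (k : ℕ → ℕ) (x : ℕ → Fin (n - 1))
    {a b d : ℕ} (had : a ≤ d) (hdb : d < b)
    (h1 : ∀ i, i < b → i ≠ d → f (i + 1) (x (i + 1)) ≤ f i (x i))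
    (h2 : f d (x d) = k d) (h3 : f (d + 1) (x (d + 1)) < k d) (hab : x a = x b) :
    (fun t => wd n f k (lp (2 * a) (2 * b) t)) ∈ (FB n).Lang := by
  let r : ℕ → FBState n := fun t => if t = 2 * d + 1 then none else some (x (t / 2))
  have hlt : 2 * a < 2 * b := by omega
  have hre : ∀ i, r (2 * i) = some (x i) := by
    intro i
    have : 2 * i ≠ 2 * d + 1 := by omega
    simp [r, this]
  have hro : ∀ i, i ≠ d → r (2 * i + 1) = some (x i) := by
    intro i hi
    have h2 : (2 * i + 1) / 2 = i := by omega
    simp [r, hi, h2]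
  have hrd : r (2 * d + 1) = none := by simp [r]
  have hrun : ∀ i, i < 2 * b → (FB n).Δ (r i) (wd n f k i) (r (i + 1)) := by
    intro t ht
    show (r t, r (t + 1)) ∈ wd n f k t
    rcases Nat.even_or_odd' t with ⟨j, rfl | rfl⟩
    · rw [wd_even, hre]
      refine ⟨x j, rfl, ?_⟩
      by_cases hj : j = d
      · subst hj; right; exact ⟨hrd, h2⟩
      · left; exact hro j hj
    · rw [wd_odd, show 2 * j + 1 + 1 = 2 * (j + 1) by ring, hre]
      refine ⟨x (j + 1), rfl, ?_⟩
      by_cases hj : j = d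
      · subst hj; right; exact ⟨hrd, h3⟩
      · left; exact ⟨x j, hro j hj, h1 j (by omega) hj⟩
  have hrab : r (2 * a) = r (2 * b) := by rw [hre, hre, hab]
  refine ⟨fun t => r (lp (2 * a) (2 * b) t), ?_, ?_, none, ?_, rfl⟩
  · show r (lp (2 * a) (2 * b) 0) ≠ none
    rw [lp_zero]
    have := hre 0
    simp only [Nat.mul_zero] at this
    rw [this]; simp
  · intro i
    exact loop_run (FB n).Δ (wd n f k) r hlt hrun hrab i
  · rw [loop_inf r hlt]
    exact ⟨2 * d + 1, by omega, by omega, hrd⟩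

lemma path_mem (n m : ℕ) (hm : 1 ≤ m) (f : ℕ → Fin (n - 1) → ℕ) (k : ℕ → ℕ)
    (hf : ∀ i, QRanking n m (f i)) {a b : ℕ} (hab : a + 4 * m ≤ b)
    (ha : ∀ j, j < 2 * m → f (a + j) = f a ∧ k (a + j) = j)
    (hb : ∀ j, j < 2 * m → f (b - 2 * m + j) = f b ∧ k (b - 2 * m + j) = j)
    (p : Fin (n - 1)) (hp : f b p < f a p) :
    (fun t => wd n f k (lp (2 * a) (2 * b) t)) ∈ (FB n).Lang := by
  have hod : ∀ i r, ∃ q, r < 2 * m → Odd r → f i q = r := by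
    intro i r
    by_cases h : r < 2 * m ∧ Odd r
    · obtain ⟨q, hq⟩ := (hf i).2 r h.1 h.2
      exact ⟨q, fun _ _ => hq⟩
    · exact ⟨p, fun h1 h2 => absurd ⟨h1, h2⟩ h⟩
  choose od hod using hod
  have htop : ∀ i, f i (od i (2 * m - 1)) = 2 * m - 1 := fun i =>
    hod i _ (by omega) ⟨m - 1, by omega⟩
  have hlt : ∀ i q, f i q ≤ 2 * m - 1 := fun i q => by
    have := (hf i).1 q; omega
  obtain ⟨c, hc⟩ : ∃ c, c = f a p := ⟨_, rfl⟩
  have hc2 : c < 2 * m := hc ▸ (hf a).1 p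
  rcases Nat.even_or_odd c with hev | hodd
  · have hc1 : Odd (c - 1) := by
      obtain ⟨e, he⟩ := hev
      exact ⟨e - 1, by omega⟩
    have hk : ∀ i, f i (od i (c - 1)) = c - 1 := fun i => hod i _ (by omega) hc1
    have hfa : ∀ i, a ≤ i → i ≤ a + c → f i = f a := by
      intro i h1 h2
      have := (ha (i - a) (by omega)).1
      rwa [show a + (i - a) = i by omega] at this
    let x : ℕ → Fin (n - 1) := fun i => if i < a then od i (2 * m - 1) else
      if i ≤ a + c then p else if i < b then od i (c - 1) else p
    have x1 : ∀ i, i < a → x i = od i (2 * m - 1) := fun i h => by simp [x, h]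
    have x2 : ∀ i, a ≤ i → i ≤ a + c → x i = p := fun i h h' => by
      simp [x, h', Nat.not_lt.2 h]
    have x3 : ∀ i, a + c < i → i < b → x i = od i (c - 1) := fun i h h' => by
      have e1 : ¬ i < a := by omega
      have e2 : ¬ i ≤ a + c := by omega
      simp [x, e1, e2, h']
    have x4 : x b = p := by
      have e1 : ¬ b < a := by omega
      simp [x, e1]
    refine wd_loop_mem n f k x (d := a + c) (by omega) (by omega) ?_ ?_ ?_ ?_
    · intro i hi hne
      by_cases h1 : i < a
      · rw [x1 i h1, htop]; exact hlt _ _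
      · by_cases h2 : i < a + c
        · rw [x2 i (by omega) (by omega), x2 (i + 1) (by omega) (by omega),
            hfa i (by omega) (by omega), hfa (i + 1) (by omega) (by omega)]
        · rw [x3 i (by omega) hi, hk]
          by_cases h3 : i + 1 < b
          · rw [x3 (i + 1) (by omega) h3, hk]
          · have : i + 1 = b := by omega
            rw [this, x4]; omega
    · rw [x2 _ (by omega) (by omega), (ha c hc2).1, (ha c hc2).2, hc]
    · rw [x3 _ (by omega) (by omega), hk, (ha c hc2).2]; omega
    · rw [x4, x2 a (by omega) (by omega)]
  · have hk : ∀ i, f i (od i c) = c := fun i => hod i _ (by omega) hodd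
    have hfb : ∀ i, b - 2 * m ≤ i → i ≤ b → f i = f b := by
      intro i h1 h2
      by_cases h3 : i = b
      · rw [h3]
      · have := (hb (i - (b - 2 * m)) (by omega)).1
        rwa [show b - 2 * m + (i - (b - 2 * m)) = i by omega] at this
    obtain ⟨d, hd⟩ : ∃ d, d = b - 2 * m + c := ⟨_, rfl⟩
    let x : ℕ → Fin (n - 1) := fun i => if i < a then od i (2 * m - 1) else
      if i ≤ a then p else if i ≤ d then od i c else p
    have x1 : ∀ i, i < a → x i = od i (2 * m - 1) := fun i h => by simp [x, h]
    have x2 : x a = p := by simp [x]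
    have x3 : ∀ i, a < i → i ≤ d → x i = od i c := fun i h h' => by
      have e1 : ¬ i < a := by omega
      have e2 : ¬ i ≤ a := by omega
      simp [x, e1, e2, h']
    have x4 : ∀ i, d < i → x i = p := fun i h => by
      have e1 : ¬ i < a := by omega
      have e2 : ¬ i ≤ a := by omega
      have e3 : ¬ i ≤ d := by omega
      simp [x, e1, e2, e3]
    have hkd : k d = c := by rw [hd]; exact (hb c hc2).2
    refine wd_loop_mem n f k x (d := d) (by omega) (by omega) ?_ ?_ ?_ ?_
    · intro i hi hne
      by_cases h1 : i < a
      · rw [x1 i h1, htop]; exact hlt _ _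
      · by_cases h2 : i = a
        · subst h2
          rw [x2, x3 _ (by omega) (by omega), hk, hc]
        · by_cases h3 : i < d
          · rw [x3 i (by omega) (by omega), x3 (i + 1) (by omega) (by omega), hk, hk]
          · rw [x4 i (by omega), x4 (i + 1) (by omega), hfb i (by omega) (by omega),
              hfb (i + 1) (by omega) (by omega)]
    · rw [x3 d (by omega) (by omega), hk, hkd]
    · rw [x4 _ (by omega), hkd, hfb (d + 1) (by omega) (by omega)]; omega
    · rw [x2, x4 b (by omega)]

lemma exists_inf_seq (R : Type*) [Nonempty R] [Countable R] :
    ∃ F : ℕ → R, ∀ r N, ∃ B, N ≤ B ∧ F B = r := by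
  obtain ⟨g, hg⟩ := exists_surjective_nat (R × ℕ)
  refine ⟨fun i => (g i).1, fun r N => ?_⟩
  by_contra hcon
  push Not at hcon
  choose u hu using fun j : ℕ => hg (r, j)
  have hinj : Function.Injective u := fun i j h => by
    have h1 := hu i
    rw [h, hu j] at h1
    simpa using h1.symm
  have hlt : ∀ j, u j < N := fun j => by
    by_contra h
    exact hcon (u j) (by omega) (by rw [hu])
  have hfin : (Set.range u).Finite := (Set.finite_lt_nat N).subset (by
    rintro _ ⟨j, rfl⟩; exact hlt j)
  exact Set.infinite_range_of_injective hinj hfin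

lemma pigeon {T : Type*} [Fintype T] (P : ℕ → T → Prop)
    (h : ∀ N, ∃ B, N ≤ B ∧ ∃ t, P B t) : ∃ t, ∀ N, ∃ B, N ≤ B ∧ P B t := by
  by_contra hcon
  push Not at hcon
  choose u hu using hcon
  obtain ⟨B, hB, t, ht⟩ := h (Finset.univ.sup u)
  exact hu t B (le_trans (Finset.le_sup (Finset.mem_univ t)) hB) ht

lemma trans_bound {T : Type*} [Fintype T] (ρ : ℕ → T) :
    ∃ N, ∀ t, N ≤ t → ρ t ∈ InfOcc ρ := by
  have : ∀ s, ∃ N, s ∈ InfOcc ρ ∨ ∀ t, N ≤ t → ρ t ≠ s := by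
    intro s
    by_cases h : s ∈ InfOcc ρ
    · exact ⟨0, Or.inl h⟩
    · simp only [InfOcc, Set.mem_setOf_eq] at h
      push Not at h
      obtain ⟨N, hN⟩ := h
      exact ⟨N, Or.inr hN⟩
  choose u hu using this
  refine ⟨Finset.univ.sup u, fun t ht => ?_⟩
  rcases hu (ρ t) with h | h
  · exact h
  · exact absurd rfl (h t (le_trans (Finset.le_sup (Finset.mem_univ _)) ht))

lemma visit_bound {T : Type*} [Fintype T] (ρ : ℕ → T) (a : ℕ) :
    ∃ N, ∀ s ∈ InfOcc ρ, ∃ t, a ≤ t ∧ t < N ∧ ρ t = s := by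
  have : ∀ s, ∃ t, s ∈ InfOcc ρ → a ≤ t ∧ ρ t = s := by
    intro s
    by_cases h : s ∈ InfOcc ρ
    · obtain ⟨t, ht⟩ := h a
      exact ⟨t, fun _ => ht⟩
    · exact ⟨0, fun h' => absurd h' h⟩
  choose u hu using this
  refine ⟨Finset.univ.sup u + 1, fun s hs => ⟨u s, (hu s hs).1, ?_, (hu s hs).2⟩⟩
  exact Nat.lt_succ_of_le (Finset.le_sup (Finset.mem_univ s))

lemma main_m (n m : ℕ) (hm : 1 ≤ m)
    (T : Type) [Fintype T] (C : NMW (FBAlpha n) T) (hC : C.Lang = (FB n).Langᶜ) :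
    Lnm n m ≤ Fintype.card T := by
  unfold Lnm
  rcases isEmpty_or_nonempty {g : Fin (n - 1) → ℕ // QRanking n m g} with hE | hE
  · simp
  obtain ⟨F, hF⟩ := exists_inf_seq {g : Fin (n - 1) → ℕ // QRanking n m g}
  let f : ℕ → Fin (n - 1) → ℕ := fun i => (F (i / (4 * m))).1
  let k : ℕ → ℕ := fun i => i % (2 * m)
  have hf : ∀ i, QRanking n m (f i) := fun i => (F _).2
  have hα : wd n f k ∈ C.Lang := by
    rw [hC]; exact wd_not_mem n f k
  obtain ⟨ρ, hρ0, hρ, hacc⟩ := hα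
  -- block facts
  have hdiv : ∀ B j, j < 4 * m → f (4 * m * B + j) = (F B).1 := by
    intro B j hj
    have : (4 * m * B + j) / (4 * m) = B := by
      rw [Nat.mul_add_div (by omega), Nat.div_eq_of_lt hj, Nat.add_zero]
    simp only [f, this]
  have hmod1 : ∀ B j, j < 2 * m → k (4 * m * B + j) = j := by
    intro B j hj
    simp only [k]
    rw [show 4 * m * B + j = 2 * m * (2 * B) + j by ring, Nat.mul_add_mod, Nat.mod_eq_of_lt hj]
  have hmod2 : ∀ B j, j < 2 * m → k (4 * m * B + 2 * m + j) = j := by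
    intro B j hj
    simp only [k]
    rw [show 4 * m * B + 2 * m + j = 2 * m * (2 * B + 1) + j by ring, Nat.mul_add_mod,
      Nat.mod_eq_of_lt hj]
  have hpig : ∀ r, ∃ t, ∀ N, ∃ B, N ≤ B ∧ (F B = r ∧ ρ (2 * (4 * m * B + 2 * m)) = t) := by
    intro r
    apply pigeon (fun B t => F B = r ∧ ρ (2 * (4 * m * B + 2 * m)) = t)
    intro N
    obtain ⟨B, hB, h⟩ := hF r N
    exact ⟨B, hB, _, h, rfl⟩
  choose q hq using hpig
  have hkey : ∀ r r', q r = q r' → ∀ p, ¬ (r'.1 p < r.1 p) := by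
    intro r r' hqq p hp
    obtain ⟨N0, hN0⟩ := trans_bound ρ
    obtain ⟨B1, hB1, hr1, hq1⟩ := hq r N0
    obtain ⟨a, ha⟩ : ∃ a, a = 4 * m * B1 + 2 * m := ⟨_, rfl⟩
    obtain ⟨N1, hN1⟩ := visit_bound ρ (2 * a)
    obtain ⟨B2, hB2, hr2, hq2⟩ := hq r' (N1 + B1 + 1)
    obtain ⟨b, hb⟩ : ∃ b, b = 4 * m * B2 + 2 * m := ⟨_, rfl⟩
    have e1 : B1 ≤ 4 * m * B1 := Nat.le_mul_of_pos_left _ (by omega)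
    have e2 : B2 ≤ 4 * m * B2 := Nat.le_mul_of_pos_left _ (by omega)
    have e3 : 4 * m * (B1 + 1) ≤ 4 * m * B2 := Nat.mul_le_mul_left _ (by omega)
    have e4 : a + 4 * m ≤ b := by rw [ha, hb]; linarith
    have hfa : f a = r.1 := by rw [ha, hdiv B1 _ (by omega), hr1]
    have hfb : f b = r'.1 := by rw [hb, hdiv B2 _ (by omega), hr2]
    have hmem : (fun t => wd n f k (lp (2 * a) (2 * b) t)) ∈ (FB n).Lang := by
      refine path_mem n m hm f k hf e4 ?_ ?_ p (by rw [hfa, hfb]; exact hp)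
      · intro j hj
        rw [hfa, ha, hmod2 B1 j hj, Nat.add_assoc, hdiv B1 _ (by omega), hr1]
        exact ⟨rfl, rfl⟩
      · intro j hj
        have : b - 2 * m + j = 4 * m * B2 + j := by omega
        rw [hfb, this, hmod1 B2 j hj, hdiv B2 _ (by omega), hr2]
        exact ⟨rfl, rfl⟩
    have hlt : 2 * a < 2 * b := by omega
    have hC' : (fun t => wd n f k (lp (2 * a) (2 * b) t)) ∈ C.Lang := by
      refine ⟨fun t => ρ (lp (2 * a) (2 * b) t), ?_, ?_, ?_⟩
      · simpa only [lp_zero] using hρ0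
      · intro i
        refine loop_run C.Δ (wd n f k) ρ hlt (fun i _ => hρ i) ?_ i
        rw [ha, hb, hq1, hq2, hqq]
      · have : InfOcc (fun t => ρ (lp (2 * a) (2 * b) t)) = InfOcc ρ := by
          ext s
          rw [loop_inf ρ hlt]
          constructor
          · rintro ⟨t, h1, -, rfl⟩
            exact hN0 t (by omega)
          · intro hs
            obtain ⟨t, h1, h2, h3⟩ := hN1 s hs
            exact ⟨t, h1, by omega, h3⟩
        rw [this]; exact hacc
    rw [hC] at hC'
    exact hC' hmem
  have hinj : Function.Injective q := by
    intro r r' h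
    apply Subtype.ext
    funext p
    have h1 := hkey r r' h p
    have h2 := hkey r' r h.symm p
    omega
  rw [← Nat.card_eq_fintype_card]
  exact Nat.card_le_card_of_injective q hinj

/-- every nondeterministic Muller automaton accepting the complement of
`L(FB n)` has at least `L(n)` states. -/
theorem muller_complementation_lower_bound (n : ℕ) (hn : 1 < n)
    (T : Type) [Fintype T] (C : NMW (FBAlpha n) T) (hC : C.Lang = (FB n).Langᶜ) :
    Lmax n ≤ Fintype.card T := by
  unfold Lmax
  refine Finset.sup_le fun m hm => ?_
  exact main_m n m (Finset.mem_Ico.1 hm).1 T C hC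

end YanPaper
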